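/- Let P ⊂ ℝⁿ be a bounded open convex polytope containing the origin, presented as P = {x : ⟨l_i, x⟩ < λ_i, i = 1,…,d}, satisfying the Delzant condition. For every c > 0 there exist constants C = C(c) and C' = C'(c), depending only on P and c, such that for every K > 0 and every u ∈ 𝒞⋆^K(P) with Alexandrov Hessian H, ∫_P log(det H(x)) dx ≤ c ∫_{∂P} u dσ + C ∫_P u(x) dx + C', where on the left the integral is well defined in [−∞, ∞) and on the right u denotes also the radial boundary extension of u. -/

import Mathlib

open MeasureTheory Filter Set Metric
open scoped ENNReal RealInnerProductSpace Topology NNReal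

noncomputable section

namespace ToricExtremal

/-- The open polytope `{x | ⟨l i, x⟩ < λ i for all i}` determined by a half-space
presentation with normals `l` and constants `lam`. -/
def Poly {n : ℕ} {ι : Type*} [Fintype ι] (l : ι → EuclideanSpace ℝ (Fin n))
    (lam : ι → ℝ) : Set (EuclideanSpace ℝ (Fin n)) :=
  {x | ∀ i, ⟪l i, x⟫ < lam i}

/-- The inner polytope `P_δ`, whose facets are parallel to those of `P` at distance `δ`. -/
def PolyInner {n : ℕ} {ι : Type*} [Fintype ι] (l : ι → EuclideanSpace ℝ (Fin n))
    (lam : ι → ℝ) (δ : ℝ) : Set (EuclideanSpace ℝ (Fin n)) :=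
  {x | ∀ i, ⟪l i, x⟫ < lam i - ‖l i‖ * δ}

/-- The facet `F i = {x ∈ ∂P | ⟨l i, x⟩ = λ i}`. -/
def Facet {n : ℕ} {ι : Type*} [Fintype ι] (l : ι → EuclideanSpace ℝ (Fin n))
    (lam : ι → ℝ) (i : ι) : Set (EuclideanSpace ℝ (Fin n)) :=
  {x ∈ frontier (Poly l lam) | ⟪l i, x⟫ = lam i}

/-- `σ₀`: the `(n-1)`-dimensional Hausdorff measure on `ℝⁿ`. -/
def sigma0 (n : ℕ) : Measure (EuclideanSpace ℝ (Fin n)) := μH[(n : ℝ) - 1]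

/-- The weighted boundary measure `σ`, equal to `|l i|⁻¹ σ₀` on the facet `F i`. -/
def sigmaW {n : ℕ} {ι : Type*} [Fintype ι] (l : ι → EuclideanSpace ℝ (Fin n))
    (lam : ι → ℝ) : Measure (EuclideanSpace ℝ (Fin n)) :=
  ∑ i : ι, (ENNReal.ofReal (1 / ‖l i‖)) • ((sigma0 n).restrict (Facet l lam i))

/-- The Delzant condition: every normal `l i` is a primitive integral vector, and every
vertex (extreme point of the closure) lies on exactly `n` facets whose normals form a
`ℤ`-basis of `ℤⁿ` (equivalently, an integral matrix of determinant `±1`). -/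
def IsDelzant {n : ℕ} {ι : Type*} [Fintype ι] (l : ι → EuclideanSpace ℝ (Fin n))
    (lam : ι → ℝ) : Prop :=
  (∀ i j, ∃ m : ℤ, l i j = (m : ℝ)) ∧
  (∀ i, ∀ k : ℕ, 2 ≤ k → ¬ (∀ j, ∃ m : ℤ, l i j = (k : ℝ) * (m : ℝ))) ∧
  (∀ x ∈ Set.extremePoints ℝ (closure (Poly l lam)),
    ∃ e : Fin n ≃ {i : ι // ⟪l i, x⟫ = lam i},
      |(Matrix.of fun j k => l (e j).1 k).det| = 1)

/-- The second partial derivative `∂²u/∂xᵢ∂xⱼ` at `x`. -/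
def secondPartial {n : ℕ} (u : EuclideanSpace ℝ (Fin n) → ℝ) (i j : Fin n)
    (x : EuclideanSpace ℝ (Fin n)) : ℝ :=
  iteratedFDeriv ℝ 2 u x ![EuclideanSpace.single i 1, EuclideanSpace.single j 1]

/-- The (classical) Hessian matrix `D²u(x)`. -/
def hessianMatrix {n : ℕ} (u : EuclideanSpace ℝ (Fin n) → ℝ)
    (x : EuclideanSpace ℝ (Fin n)) : Matrix (Fin n) (Fin n) ℝ :=
  Matrix.of fun i j => secondPartial u i j x

/-- Guillemin's canonical potential `u_P(x) = Σᵢ (λᵢ − ⟨lᵢ,x⟩) log (λᵢ − ⟨lᵢ,x⟩)`. -/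
def guillemin {n : ℕ} {ι : Type*} [Fintype ι] (l : ι → EuclideanSpace ℝ (Fin n))
    (lam : ι → ℝ) (x : EuclideanSpace ℝ (Fin n)) : ℝ :=
  ∑ i : ι, (lam i - ⟪l i, x⟫) * Real.log (lam i - ⟪l i, x⟫)

/-- `(u_P)^{ij}_{ij}`: the double divergence `Σ_{i,j} ∂²((D²u_P)⁻¹)_{ij}/∂xᵢ∂xⱼ` of the
inverse Hessian of the Guillemin potential. -/
def divDivInvHessGuillemin {n : ℕ} {ι : Type*} [Fintype ι]
    (l : ι → EuclideanSpace ℝ (Fin n)) (lam : ι → ℝ) (x : EuclideanSpace ℝ (Fin n)) : ℝ :=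
  ∑ i : Fin n, ∑ j : Fin n,
    secondPartial (fun y => (hessianMatrix (guillemin l lam) y)⁻¹ i j) i j x

/-- `H` is an Alexandrov Hessian of `u` on `P`: a measurable matrix-valued map which is
a.e. positive semidefinite and gives the second-order Taylor expansion of `u` at a.e.
point of `P`. -/
def IsAlexHessian {n : ℕ} (P : Set (EuclideanSpace ℝ (Fin n)))
    (u : EuclideanSpace ℝ (Fin n) → ℝ)
    (H : EuclideanSpace ℝ (Fin n) → Matrix (Fin n) (Fin n) ℝ) : Prop :=
  (∀ i j, Measurable fun x => H x i j) ∧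
  ∀ᵐ x ∂(volume.restrict P),
    (H x).PosSemidef ∧
    ∃ g : EuclideanSpace ℝ (Fin n),
      Tendsto (fun y : EuclideanSpace ℝ (Fin n) =>
          (u y - u x - ⟪g, y - x⟫
            - (1 / 2) * ∑ i : Fin n, ∑ j : Fin n, H x i j * (y - x) i * (y - x) j)
          / ‖y - x‖ ^ 2)
        (𝓝[≠] x) (𝓝 0)

/-- The radial boundary extension `u(z) = lim_{t→1⁻} u (t • z)` (as a value in `[0,∞]`,
computed via `limsup` so as to be everywhere defined). -/
def radExt {n : ℕ} (u : EuclideanSpace ℝ (Fin n) → ℝ) (z : EuclideanSpace ℝ (Fin n)) : ℝ≥0∞ :=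
  Filter.limsup (fun t : ℝ => ENNReal.ofReal (u (t • z))) (𝓝[<] (1 : ℝ))

/-- The radial limits of `u` exist (in `[0,∞]`) at every boundary point of `P`. -/
def HasRadExt {n : ℕ} (P : Set (EuclideanSpace ℝ (Fin n)))
    (u : EuclideanSpace ℝ (Fin n) → ℝ) : Prop :=
  ∀ z ∈ frontier P,
    Tendsto (fun t : ℝ => ENNReal.ofReal (u (t • z))) (𝓝[<] (1 : ℝ)) (𝓝 (radExt u z))

/-- The class `𝒞⋆^K(P)`: nonnegative convex functions on `P`, vanishing at the origin,
whose radial boundary extension has `σ₀`-integral at most `K`. -/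
def MemCstar {n : ℕ} {ι : Type*} [Fintype ι] (l : ι → EuclideanSpace ℝ (Fin n))
    (lam : ι → ℝ) (K : ℝ) (u : EuclideanSpace ℝ (Fin n) → ℝ) : Prop :=
  ConvexOn ℝ (Poly l lam) u ∧ u 0 = 0 ∧ (∀ x ∈ Poly l lam, 0 ≤ u x) ∧
  HasRadExt (Poly l lam) u ∧
  ∫⁻ z in frontier (Poly l lam), radExt u z ∂(sigma0 n) ≤ ENNReal.ofReal K

/-- The class `𝒞`: convex functions of the form `u = u_P + v` with `v` smooth up to the
boundary of `P`. -/
def MemC {n : ℕ} {ι : Type*} [Fintype ι] (l : ι → EuclideanSpace ℝ (Fin n))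
    (lam : ι → ℝ) (u : EuclideanSpace ℝ (Fin n) → ℝ) : Prop :=
  ConvexOn ℝ (Poly l lam) u ∧
  ∃ v : EuclideanSpace ℝ (Fin n) → ℝ, ContDiffOn ℝ (⊤ : ℕ∞) v (closure (Poly l lam)) ∧
    ∀ x ∈ closure (Poly l lam), u x = guillemin l lam x + v x

/-- The normalized class `𝒞̃ = {u ∈ 𝒞 : inf_P u = u 0 = 0}`. -/
def MemCt {n : ℕ} {ι : Type*} [Fintype ι] (l : ι → EuclideanSpace ℝ (Fin n))
    (lam : ι → ℝ) (u : EuclideanSpace ℝ (Fin n) → ℝ) : Prop :=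
  MemC l lam u ∧ u 0 = 0 ∧ ∀ x ∈ Poly l lam, 0 ≤ u x

/-- `f` is an affine function on `ℝⁿ`. -/
def IsAffineFn {n : ℕ} (f : EuclideanSpace ℝ (Fin n) → ℝ) : Prop :=
  ∃ (g : EuclideanSpace ℝ (Fin n)) (c : ℝ), ∀ x, f x = ⟪g, x⟫ + c

/-- The (signed) integral `∫_S log (det H) dx`, with values in `EReal`: it is defined as
the difference of the integrals of the positive part `log⁺` and the negative part `log⁻`. -/
def logDetE {n : ℕ} (S : Set (EuclideanSpace ℝ (Fin n)))
    (H : EuclideanSpace ℝ (Fin n) → Matrix (Fin n) (Fin n) ℝ) : EReal :=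
  ((∫⁻ x in S, ENNReal.ofReal (Real.log (H x).det) : ℝ≥0∞) : EReal)
    - ((∫⁻ x in S, ENNReal.ofReal (-Real.log (H x).det) : ℝ≥0∞) : EReal)

/-- The Donaldson functional
`ℱ(u) = −∫_P log (det H) dx + ∫_{∂P} u dσ − ∫_P f ⬝ u dx`, valued in `EReal`, where `H` is
an Alexandrov Hessian of `u` and the boundary term uses the radial extension of `u`. -/
def Fcal {n : ℕ} {ι : Type*} [Fintype ι] (l : ι → EuclideanSpace ℝ (Fin n)) (lam : ι → ℝ)
    (f : EuclideanSpace ℝ (Fin n) → ℝ) (u : EuclideanSpace ℝ (Fin n) → ℝ)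
    (H : EuclideanSpace ℝ (Fin n) → Matrix (Fin n) (Fin n) ℝ) : EReal :=
  ((∫⁻ z, radExt u z ∂(sigmaW l lam) : ℝ≥0∞) : EReal)
    - ((∫ x in Poly l lam, f x * u x : ℝ) : EReal)
    - logDetE (Poly l lam) H

/-- The half-space presentation of the open rectangle `∏ (αᵢ, βᵢ)`: normals. -/
def rectL (n : ℕ) : (Fin n ⊕ Fin n) → EuclideanSpace ℝ (Fin n) :=
  Sum.elim (fun i => EuclideanSpace.single i 1) (fun i => -EuclideanSpace.single i 1)

/-- The half-space presentation of the open rectangle `∏ (αᵢ, βᵢ)`: constants. -/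
def rectLam {n : ℕ} (α β : Fin n → ℝ) : (Fin n ⊕ Fin n) → ℝ :=
  Sum.elim β (fun i => -α i)


/-- The functional `ℱ` on smooth elements of `𝒞̃` (real-valued):
`ℱ(u) = −∫_P log det D²u + ∫_{∂P} u dσ − ∫_P f ⬝ u dx`. -/
def FcalSmooth {n : ℕ} {ι : Type*} [Fintype ι] (l : ι → EuclideanSpace ℝ (Fin n))
    (lam : ι → ℝ) (f u : EuclideanSpace ℝ (Fin n) → ℝ) : ℝ :=
  -(∫ x in Poly l lam, Real.log ((hessianMatrix u x).det))
    + ((∫ z, u z ∂(sigmaW l lam)) - ∫ x in Poly l lam, f x * u x)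

lemma sq_max_second_difference_le {p q m b : ℝ} (hm : p + q ≤ 2 * m) (hb : |p - q| ≤ 2 * b) :
    max p 0 ^ 2 + max q 0 ^ 2 - 2 * max m 0 ^ 2 ≤ 2 * b ^ 2 := by
  have hb' : (p - q) ^ 2 ≤ (2 * b) ^ 2 := sq_le_sq' (by linarith [abs_le.1 hb]) (abs_le.1 hb).2
  have hm' : max (p + q) 0 ^ 2 ≤ 4 * max m 0 ^ 2 := by
    have h : max (p + q) 0 ≤ 2 * max m 0 :=
      max_le (by linarith [le_max_left m 0]) (by linarith [le_max_right m 0])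
    nlinarith [le_max_right (p + q) 0]
  rcases le_total p 0 with hp | hp <;> rcases le_total q 0 with hq | hq <;>
    rcases le_total (p + q) 0 with hpq | hpq <;>
    simp only [max_eq_left, max_eq_right, hp, hq, hpq] at hm' ⊢ <;>
    nlinarith

/-- The function `(1 - γ)₊²`, where `γ` is the gauge of `P`. -/
def bump {n : ℕ} (P : Set (EuclideanSpace ℝ (Fin n))) (x : EuclideanSpace ℝ (Fin n)) : ℝ :=
  max (1 - gauge P x) 0 ^ 2

section ConvexBody

open scoped Pointwise

variable {n : ℕ} {P : Set (EuclideanSpace ℝ (Fin n))}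

lemma bump_nonneg (x : EuclideanSpace ℝ (Fin n)) : 0 ≤ bump P x := sq_nonneg _

lemma bump_le_one (x : EuclideanSpace ℝ (Fin n)) : bump P x ≤ 1 := by
  have h := gauge_nonneg (s := P) x
  exact pow_le_one₀ (le_max_right _ _) (max_le (by linarith) zero_le_one)

lemma gauge_lt_one_iff (hc : Convex ℝ P) (ho : IsOpen P) (h0 : (0 : EuclideanSpace ℝ (Fin n)) ∈ P)
    (x : EuclideanSpace ℝ (Fin n)) : gauge P x < 1 ↔ x ∈ P := by
  rw [gauge_lt_one_iff_mem_interior hc (ho.mem_nhds h0), ho.interior_eq]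

lemma bump_eq_zero (hc : Convex ℝ P) (ho : IsOpen P) (h0 : (0 : EuclideanSpace ℝ (Fin n)) ∈ P)
    {x : EuclideanSpace ℝ (Fin n)} (hx : x ∉ P) : bump P x = 0 := by
  rw [← gauge_lt_one_iff hc ho h0, not_lt] at hx
  simp [bump, hx]

lemma continuous_bump (hc : Convex ℝ P) (ho : IsOpen P)
    (h0 : (0 : EuclideanSpace ℝ (Fin n)) ∈ P) : Continuous (bump P) := by
  have := continuous_gauge hc (ho.mem_nhds h0)
  unfold bump
  fun_prop

/-- The function `bump P` is semiconcave on the whole space. -/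
lemma exists_bump_second_difference_le (hc : Convex ℝ P) (ho : IsOpen P)
    (h0 : (0 : EuclideanSpace ℝ (Fin n)) ∈ P) :
    ∃ M : ℝ, 0 ≤ M ∧ ∀ y v : EuclideanSpace ℝ (Fin n),
      bump P (y + v) + bump P (y - v) - 2 * bump P y ≤ M * ‖v‖ ^ 2 := by
  obtain ⟨K, hK⟩ := hc.lipschitz_gauge (ho.mem_nhds h0)
  refine ⟨2 * (K : ℝ) ^ 2, by positivity, fun y v => ?_⟩
  have hadd := gauge_add_le hc (absorbent_nhds_zero (ho.mem_nhds h0)) (y + v) (y - v)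
  have hy : y + v + (y - v) = (2 : ℝ) • y := by rw [two_smul]; abel
  rw [hy, gauge_smul_of_nonneg zero_le_two, smul_eq_mul] at hadd
  have hlip := hK.dist_le_mul (y - v) (y + v)
  have hv : dist (y - v) (y + v) = 2 * ‖v‖ := by
    rw [dist_eq_norm, show y - v - (y + v) = (-2 : ℝ) • v by rw [neg_smul, two_smul]; abel,
      norm_smul]
    norm_num
  rw [hv, Real.dist_eq] at hlip
  have := sq_max_second_difference_le (p := 1 - gauge P (y + v)) (q := 1 - gauge P (y - v))
    (m := 1 - gauge P y) (b := K * ‖v‖) (by linarith)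
    (by rw [show 1 - gauge P (y + v) - (1 - gauge P (y - v))
          = gauge P (y - v) - gauge P (y + v) by ring]; linarith)
  calc _ ≤ _ := this
    _ = _ := by ring

lemma volume_gauge_gt_le (hc : Convex ℝ P) (ho : IsOpen P)
    (h0 : (0 : EuclideanSpace ℝ (Fin n)) ∈ P) (hb : Bornology.IsBounded P) {s : ℝ}
    (hs0 : 0 < s) (hs1 : s < 1) :
    volume {x ∈ P | s < gauge P x} ≤ ENNReal.ofReal (n * (1 - s)) * volume P := by
  have hsub : s • P ⊆ P := by
    rintro _ ⟨x, hx, rfl⟩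
    exact (hc.starConvex h0).smul_mem hx hs0.le hs1.le
  have hfin : volume (s • P) ≠ ∞ := (hb.smul₀ s).measure_lt_top.ne
  have hmeas : MeasurableSet (s • P) := (ho.smul₀ hs0.ne').measurableSet
  calc volume {x ∈ P | s < gauge P x} ≤ volume (P \ s • P) := by
        refine measure_mono fun x hx => ⟨hx.1, fun hxs => ?_⟩
        exact absurd (gauge_le_of_mem hs0.le hxs) (not_le.2 hx.2)
    _ = volume P - ENNReal.ofReal (s ^ n) * volume P := by
        rw [measure_sdiff hsub hmeas.nullMeasurableSet hfin, Measure.addHaar_smul,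
          finrank_euclideanSpace_fin, abs_of_nonneg (by positivity)]
    _ ≤ ENNReal.ofReal (n * (1 - s)) * volume P := by
        rw [tsub_le_iff_right, ← add_mul, ← ENNReal.ofReal_add
          (mul_nonneg n.cast_nonneg (by linarith)) (by positivity)]
        refine le_mul_of_one_le_left' ?_
        rw [ENNReal.one_le_ofReal]
        have := one_add_mul_le_pow (a := s - 1) (by linarith) n
        rw [show 1 + (s - 1) = s by ring] at this
        linarith

lemma lintegral_neg_log_one_sub_gauge_lt_top (hc : Convex ℝ P) (ho : IsOpen P)
    (h0 : (0 : EuclideanSpace ℝ (Fin n)) ∈ P) (hb : Bornology.IsBounded P) :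
    ∫⁻ x in P, ENNReal.ofReal (-Real.log (1 - gauge P x)) < ∞ := by
  have hcont := continuous_gauge hc (ho.mem_nhds h0)
  have hPm := ho.measurableSet
  have hmeas : Measurable fun x => -Real.log (1 - gauge P x) :=
    (Real.measurable_log.comp (measurable_const.sub hcont.measurable)).neg
  rw [lintegral_eq_lintegral_meas_lt]
  · calc ∫⁻ t in Ioi (0 : ℝ), volume.restrict P {x | t < -Real.log (1 - gauge P x)}
        ≤ ∫⁻ t in Ioi (0 : ℝ), ENNReal.ofReal (n * Real.exp (-t)) * volume P := by
          refine setLIntegral_mono' measurableSet_Ioi fun t ht => ?_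
          have ht' : Real.exp (-t) < 1 := Real.exp_lt_one_iff.2 (by simpa using ht)
          rw [Measure.restrict_apply (measurableSet_lt measurable_const hmeas)]
          have := volume_gauge_gt_le hc ho h0 hb (s := 1 - Real.exp (-t)) (by linarith)
            (by linarith [Real.exp_pos (-t)])
          rw [sub_sub_cancel] at this
          refine (measure_mono ?_).trans this
          rintro x ⟨hx, hxP⟩
          refine ⟨hxP, ?_⟩
          have hpos : 0 < 1 - gauge P x := by linarith [(gauge_lt_one_iff hc ho h0 x).2 hxP]
          have : Real.log (1 - gauge P x) < -t := by
            have : t < -Real.log (1 - gauge P x) := hx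
            linarith
          rw [Real.log_lt_iff_lt_exp hpos] at this
          linarith
      _ < ∞ := by
          rw [lintegral_mul_const _ (by fun_prop)]
          refine ENNReal.mul_lt_top ?_ hb.measure_lt_top
          have hi : IntegrableOn (fun t : ℝ => n * Real.exp (-t)) (Ioi 0) := by
            have := (exp_neg_integrableOn_Ioi 0 one_pos).const_mul (n : ℝ)
            simpa [IntegrableOn] using this
          exact hi.lintegral_lt_top
  · filter_upwards [ae_restrict_mem hPm] with x hx
    have h1 := (gauge_lt_one_iff hc ho h0 x).2 hx
    have h2 := gauge_nonneg (s := P) x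
    simpa using Real.log_nonpos (by linarith) (by linarith)
  · exact hmeas.aemeasurable

lemma lintegral_neg_log_bump_lt_top (hc : Convex ℝ P) (ho : IsOpen P)
    (h0 : (0 : EuclideanSpace ℝ (Fin n)) ∈ P) (hb : Bornology.IsBounded P) :
    ∫⁻ x in P, ENNReal.ofReal (-Real.log (bump P x)) < ∞ := by
  have heq : ∫⁻ x in P, ENNReal.ofReal (-Real.log (bump P x))
      = ∫⁻ x in P, 2 * ENNReal.ofReal (-Real.log (1 - gauge P x)) := by
    refine setLIntegral_congr_fun ho.measurableSet fun x hx => ?_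
    have h1 := (gauge_lt_one_iff hc ho h0 x).2 hx
    simp only [bump]
    rw [max_eq_left (by linarith), Real.log_pow]
    have : -((2 : ℕ) * Real.log (1 - gauge P x)) = 2 * -Real.log (1 - gauge P x) := by
      push_cast; ring
    rw [this, ENNReal.ofReal_mul zero_le_two, ENNReal.ofReal_ofNat]
  rw [heq, lintegral_const_mul' _ _ (by norm_num)]
  exact ENNReal.mul_lt_top (by norm_num) (lintegral_neg_log_one_sub_gauge_lt_top hc ho h0 hb)

/-- The integrand in the second-difference estimate is nonnegative everywhere. -/
lemma bump_mul_second_difference_nonneg (hc : Convex ℝ P) (ho : IsOpen P)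
    (h0 : (0 : EuclideanSpace ℝ (Fin n)) ∈ P) {M : ℝ}
    (hM : ∀ y v : EuclideanSpace ℝ (Fin n),
      bump P (y + v) + bump P (y - v) - 2 * bump P y ≤ M * ‖v‖ ^ 2)
    {u : EuclideanSpace ℝ (Fin n) → ℝ} (hu : ConvexOn ℝ P u) (hu0 : ∀ x ∈ P, 0 ≤ u x)
    (hM0 : 0 ≤ M) (x v : EuclideanSpace ℝ (Fin n)) :
    0 ≤ bump P x * (P.indicator u (x + v) + P.indicator u (x - v) - 2 * P.indicator u x)
      + 2 * M * ‖v‖ ^ 2 * P.indicator u x := by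
  have hind : ∀ y, 0 ≤ P.indicator u y := fun y => indicator_nonneg hu0 y
  have hg := bump_nonneg (P := P) x
  by_cases hx : x ∈ P
  swap
  · rw [bump_eq_zero hc ho h0 hx, indicator_of_notMem hx]
    simp
  by_cases hpm : x + v ∈ P ∧ x - v ∈ P
  · have hmid := hu.2 hpm.1 hpm.2 (by norm_num : (0 : ℝ) ≤ 1 / 2) (by norm_num : (0 : ℝ) ≤ 1 / 2)
      (by norm_num)
    have hx' : (1 / 2 : ℝ) • (x + v) + (1 / 2 : ℝ) • (x - v) = x := by module
    rw [hx', smul_eq_mul, smul_eq_mul] at hmid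
    rw [indicator_of_mem hx, indicator_of_mem hpm.1, indicator_of_mem hpm.2]
    have hux := hu0 x hx
    exact add_nonneg (mul_nonneg hg (by linarith)) (by positivity)
  · have hsmall : bump P x ≤ M * ‖v‖ ^ 2 := by
      by_cases hp : x + v ∈ P
      · have hm : x - v ∉ P := fun h => hpm ⟨hp, h⟩
        have := hM (x - v) v
        rw [sub_add_cancel, bump_eq_zero hc ho h0 hm] at this
        linarith [bump_nonneg (P := P) (x - v - v)]
      · have := hM (x + v) v
        rw [add_sub_cancel_right, bump_eq_zero hc ho h0 hp] at this
        linarith [bump_nonneg (P := P) (x + v + v)]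
    have h1 := mul_nonneg hg (add_nonneg (hind (x + v)) (hind (x - v)))
    have h2 := mul_nonneg (sub_nonneg.2 hsmall) (hind x)
    nlinarith

lemma integral_bump_mul_second_difference_le (hc : Convex ℝ P) (ho : IsOpen P)
    (h0 : (0 : EuclideanSpace ℝ (Fin n)) ∈ P) {M : ℝ}
    (hM : ∀ y v : EuclideanSpace ℝ (Fin n),
      bump P (y + v) + bump P (y - v) - 2 * bump P y ≤ M * ‖v‖ ^ 2)
    {w : EuclideanSpace ℝ (Fin n) → ℝ} (hw0 : ∀ x, 0 ≤ w x) (hw : Integrable w)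
    (v : EuclideanSpace ℝ (Fin n)) :
    Integrable (fun x => bump P x * (w (x + v) + w (x - v) - 2 * w x)
      + 2 * M * ‖v‖ ^ 2 * w x) ∧
    ∫ x, (bump P x * (w (x + v) + w (x - v) - 2 * w x) + 2 * M * ‖v‖ ^ 2 * w x)
      ≤ 3 * M * ‖v‖ ^ 2 * ∫ x, w x := by
  have hcont := continuous_bump hc ho h0
  have hmul : ∀ (f : EuclideanSpace ℝ (Fin n) → ℝ) (a : EuclideanSpace ℝ (Fin n)),
      Integrable f → Integrable fun x => bump P (x + a) * f x := fun f a hf => by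
    refine hf.bdd_mul (c := 1)
      (hcont.comp (continuous_id.add continuous_const)).aestronglyMeasurable
      (Eventually.of_forall fun x => ?_)
    simpa [abs_of_nonneg (bump_nonneg _)] using bump_le_one (P := P) (x + a)
  have hp := hmul _ 0 (hw.comp_add_right v)
  have hm := hmul _ 0 (hw.comp_sub_right v)
  have hz := hmul _ 0 hw
  simp only [add_zero] at hp hm hz
  have hp' := hmul _ v hw
  have hm' := hmul _ (-v) hw
  simp only [← sub_eq_add_neg] at hm'
  have ep : ∫ x, bump P x * w (x + v) = ∫ x, bump P (x - v) * w x := by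
    rw [← integral_add_right_eq_self (fun x => bump P (x - v) * w x) v]
    simp
  have em : ∫ x, bump P x * w (x - v) = ∫ x, bump P (x + v) * w x := by
    rw [← integral_sub_right_eq_self (fun x => bump P (x + v) * w x) v]
    simp
  have hcw := hw.const_mul (2 * M * ‖v‖ ^ 2)
  have hz2 := hz.const_mul 2
  have hform : (fun x => bump P x * (w (x + v) + w (x - v) - 2 * w x) + 2 * M * ‖v‖ ^ 2 * w x)
      = fun x => bump P x * w (x + v) + bump P x * w (x - v) - 2 * (bump P x * w x)
        + 2 * M * ‖v‖ ^ 2 * w x := by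
    funext x; ring
  rw [hform]
  have hpm : Integrable fun x => bump P x * w (x + v) + bump P x * w (x - v) := hp.add hm
  have hpm2 : Integrable fun x => bump P x * w (x + v) + bump P x * w (x - v)
    - 2 * (bump P x * w x) := hpm.sub hz2
  have hqm : Integrable fun x => bump P (x - v) * w x + bump P (x + v) * w x := hm'.add hp'
  have hqm2 : Integrable fun x => bump P (x - v) * w x + bump P (x + v) * w x
    - 2 * (bump P x * w x) := hqm.sub hz2
  refine ⟨hpm2.add hcw, ?_⟩
  rw [integral_add hpm2 hcw, integral_sub hpm hz2, integral_add hp hm, ep, em,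
    ← integral_add hm' hp', ← integral_sub hqm hz2, ← integral_add hqm2 hcw,
    ← integral_const_mul]
  refine integral_mono (hqm2.add hcw) (hw.const_mul _) fun x => ?_
  have := mul_le_mul_of_nonneg_right (hM x v) (hw0 x)
  simp only
  nlinarith

lemma tendsto_second_difference_of_taylor {u : EuclideanSpace ℝ (Fin n) → ℝ}
    {A : Matrix (Fin n) (Fin n) ℝ} {x g : EuclideanSpace ℝ (Fin n)}
    (h : Tendsto (fun y : EuclideanSpace ℝ (Fin n) =>
          (u y - u x - ⟪g, y - x⟫
            - (1 / 2) * ∑ i : Fin n, ∑ j : Fin n, A i j * (y - x) i * (y - x) j)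
          / ‖y - x‖ ^ 2)
        (𝓝[≠] x) (𝓝 0)) (i : Fin n) :
    Tendsto (fun t : ℝ => (u (x + t • EuclideanSpace.single i 1)
        + u (x - t • EuclideanSpace.single i 1) - 2 * u x) / t ^ 2) (𝓝[≠] 0) (𝓝 (A i i)) := by
  set e : EuclideanSpace ℝ (Fin n) := EuclideanSpace.single i 1 with he
  have he0 : e ≠ 0 := by simp [he]
  have hen : ‖e‖ = 1 := by simp [he]
  have key : ∀ s : ℝ, s ≠ 0 → Tendsto (fun t : ℝ => x + (s * t) • e) (𝓝[≠] 0) (𝓝[≠] x) := by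
    intro s hs
    refine tendsto_nhdsWithin_iff.2 ⟨?_, ?_⟩
    · have : Continuous fun t : ℝ => x + (s * t) • e := by fun_prop
      refine (this.tendsto' 0 x (by simp)).mono_left nhdsWithin_le_nhds
    · filter_upwards [self_mem_nhdsWithin] with t ht
      have ht' : t ≠ 0 := ht
      simp [hs, ht', he0]
  have hsum : ∀ t : ℝ, ∑ k : Fin n, ∑ j : Fin n, A k j * (t • e) k * (t • e) j = A i i * t ^ 2 := by
    intro t
    rw [Finset.sum_eq_single i, Finset.sum_eq_single i]
    · simp [he]; ring
    · intro j _ hj; simp [he, hj]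
    · simp
    · intro k _ hk; simp [he, hk]
    · simp
  have hp := h.comp (key 1 one_ne_zero)
  have hm := h.comp (key (-1) (by norm_num))
  have hadd := (hp.add hm).add_const (A i i)
  rw [add_zero, zero_add] at hadd
  refine hadd.congr' ?_
  filter_upwards [self_mem_nhdsWithin] with t ht
  have ht' : t ≠ 0 := ht
  simp only [Function.comp_apply, add_sub_cancel_left, hsum, norm_smul, hen, mul_one,
    inner_smul_right, Real.norm_eq_abs, sq_abs]
  rw [show x + (-1 * t) • e = x - t • e by rw [neg_one_mul, neg_smul, sub_eq_add_neg], one_mul]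
  field_simp
  ring

/-- Fatou estimate for the weighted second derivatives of a nonnegative convex function. -/
lemma lintegral_bump_mul_hessian_diag_le (hc : Convex ℝ P) (ho : IsOpen P)
    (h0 : (0 : EuclideanSpace ℝ (Fin n)) ∈ P) {M : ℝ} (hM0 : 0 ≤ M)
    (hM : ∀ y v : EuclideanSpace ℝ (Fin n),
      bump P (y + v) + bump P (y - v) - 2 * bump P y ≤ M * ‖v‖ ^ 2)
    {u : EuclideanSpace ℝ (Fin n) → ℝ} (hu : ConvexOn ℝ P u) (hu0 : ∀ x ∈ P, 0 ≤ u x)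
    (hui : IntegrableOn u P) {H : EuclideanSpace ℝ (Fin n) → Matrix (Fin n) (Fin n) ℝ}
    (hH : IsAlexHessian P u H) (i : Fin n) :
    ∫⁻ x in P, ENNReal.ofReal (bump P x * H x i i)
      ≤ ENNReal.ofReal (3 * M * ∫ x in P, u x) := by
  set e : EuclideanSpace ℝ (Fin n) := EuclideanSpace.single i 1 with he
  have hen : ‖e‖ = 1 := by simp [he]
  set w := P.indicator u with hwdef
  have hw0 : ∀ y, 0 ≤ w y := fun y => indicator_nonneg hu0 y
  have hw : Integrable w := (integrable_indicator_iff ho.measurableSet).2 hui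
  set t : ℕ → ℝ := fun k => 1 / ((k : ℝ) + 1) with ht
  have htpos : ∀ k, 0 < t k := fun k => Nat.one_div_pos_of_nat
  have htlim : Tendsto t atTop (𝓝[≠] 0) :=
    tendsto_nhdsWithin_iff.2 ⟨tendsto_one_div_add_atTop_nhds_zero_nat,
      Eventually.of_forall fun k => (htpos k).ne'⟩
  let F : ℕ → EuclideanSpace ℝ (Fin n) → ℝ := fun k x =>
    bump P x * (w (x + t k • e) + w (x - t k • e) - 2 * w x) + 2 * M * ‖t k • e‖ ^ 2 * w x
  have hnorm : ∀ k, ‖t k • e‖ ^ 2 = t k ^ 2 := fun k => by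
    rw [norm_smul, hen, mul_one, Real.norm_eq_abs, sq_abs]
  have hF := fun k => integral_bump_mul_second_difference_le hc ho h0 hM hw0 hw (t k • e)
  have hF0 : ∀ k x, 0 ≤ F k x := fun k x =>
    bump_mul_second_difference_nonneg hc ho h0 hM hu hu0 hM0 x (t k • e)
  have hbound : ∀ k, ∫⁻ x in P, ENNReal.ofReal (F k x / t k ^ 2)
      ≤ ENNReal.ofReal (3 * M * ∫ x in P, u x) := by
    intro k
    refine (setLIntegral_le_lintegral _ _).trans ?_
    rw [← ofReal_integral_eq_lintegral_ofReal ((hF k).1.div_const _)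
      (Eventually.of_forall fun x => div_nonneg (hF0 k x) (sq_nonneg _)), integral_div]
    refine ENNReal.ofReal_le_ofReal ?_
    rw [div_le_iff₀ (pow_pos (htpos k) 2), ← integral_indicator ho.measurableSet]
    refine (hF k).2.trans_eq ?_
    rw [hnorm]; ring
  have hlim : ∀ᵐ x ∂(volume.restrict P), ENNReal.ofReal (bump P x * H x i i)
      ≤ liminf (fun k => ENNReal.ofReal (F k x / t k ^ 2)) atTop := by
    filter_upwards [hH.2, ae_restrict_mem ho.measurableSet] with x ⟨_, g, hg⟩ hx
    have hd := (tendsto_second_difference_of_taylor hg i).comp htlim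
    have hlim : Tendsto (fun k => F k x / t k ^ 2) atTop
        (𝓝 (bump P x * H x i i + 2 * M * u x)) := by
      refine ((hd.const_mul (bump P x)).add_const (2 * M * u x)).congr' ?_
      have hmem : ∀ s : ℝ, ∀ᶠ k in atTop, x + (s * t k) • e ∈ P := by
        intro s
        have hcts : Continuous fun r : ℝ => x + (s * r) • e := by fun_prop
        have := ((hcts.tendsto' 0 x (by simp)).comp (htlim.mono_right nhdsWithin_le_nhds))
        exact this.eventually (ho.mem_nhds hx)
      filter_upwards [hmem 1, hmem (-1)] with k h1 h2
      rw [one_mul] at h1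
      rw [neg_one_mul, neg_smul, ← sub_eq_add_neg] at h2
      have := (htpos k).ne'
      simp only [F, hnorm, hwdef, indicator_of_mem hx, indicator_of_mem h1, indicator_of_mem h2,
        Function.comp_apply, ← he]
      field_simp
    refine le_of_le_of_eq ?_ ((ENNReal.continuous_ofReal.tendsto _).comp hlim).liminf_eq.symm
    exact ENNReal.ofReal_le_ofReal
      (le_add_of_nonneg_right (mul_nonneg (by positivity) (hu0 x hx)))
  refine (lintegral_mono_ae hlim).trans ((lintegral_liminf_le' fun k => ?_).trans ?_)
  · exact ((hF k).1.div_const _).1.aemeasurable.ennreal_ofReal.restrict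
  · exact liminf_le_of_frequently_le' (Frequently.of_forall hbound)

/-- The radial projection of `P \ {0}` onto the boundary of `P`. -/
def radProj (P : Set (EuclideanSpace ℝ (Fin n))) (x : EuclideanSpace ℝ (Fin n)) :
    EuclideanSpace ℝ (Fin n) := (gauge P x)⁻¹ • x

lemma measurable_radProj (hc : Convex ℝ P) (ho : IsOpen P)
    (h0 : (0 : EuclideanSpace ℝ (Fin n)) ∈ P) : Measurable (radProj P) :=
  (continuous_gauge hc (ho.mem_nhds h0)).measurable.inv.smul measurable_id

lemma gauge_pos_of_ne_zero (ho : IsOpen P) (h0 : (0 : EuclideanSpace ℝ (Fin n)) ∈ P)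
    (hb : Bornology.IsBounded P) {x : EuclideanSpace ℝ (Fin n)} (hx : x ≠ 0) : 0 < gauge P x :=
  (gauge_pos (absorbent_nhds_zero (ho.mem_nhds h0))
    ((NormedSpace.isVonNBounded_iff ℝ).2 hb)).2 hx

lemma radProj_mem_frontier (hc : Convex ℝ P) (ho : IsOpen P)
    (h0 : (0 : EuclideanSpace ℝ (Fin n)) ∈ P) (hb : Bornology.IsBounded P)
    {x : EuclideanSpace ℝ (Fin n)} (hx : x ≠ 0) : radProj P x ∈ frontier P := by
  have hpos := gauge_pos_of_ne_zero ho h0 hb hx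
  rw [← gauge_eq_one_iff_mem_frontier hc (ho.mem_nhds h0), radProj,
    gauge_smul_of_nonneg (inv_nonneg.2 hpos.le), smul_eq_mul, inv_mul_cancel₀ hpos.ne']

/-- Volume of a cone over a piece of diameter `δ` at bounded distance from the origin. -/
lemma volume_cone_le {R δ : ℝ} (hR : 0 ≤ R) (hδ : 0 < δ) (hδ1 : δ ≤ 1)
    {z₀ : EuclideanSpace ℝ (Fin n)} (hz₀ : ‖z₀‖ ≤ R) :
    volume {x : EuclideanSpace ℝ (Fin n) |
        ∃ t : ℝ, 0 ≤ t ∧ t ≤ 1 ∧ ∃ z : EuclideanSpace ℝ (Fin n), ‖z - z₀‖ ≤ δ ∧ x = t • z}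
      ≤ ENNReal.ofReal (3 * (1 + R) ^ n)
          * volume (ball (0 : EuclideanSpace ℝ (Fin n)) 1)
          * ENNReal.ofReal δ ^ ((n : ℝ) - 1) := by
  set N := ⌈1 / δ⌉₊ with hN
  have hN1 : 1 / δ ≤ N := Nat.le_ceil _
  have hN2 : (N : ℝ) < 1 / δ + 1 := Nat.ceil_lt_add_one (by positivity)
  have hNpos : (0 : ℝ) < N := lt_of_lt_of_le (by positivity) hN1
  have hsub : {x : EuclideanSpace ℝ (Fin n) |
        ∃ t : ℝ, 0 ≤ t ∧ t ≤ 1 ∧ ∃ z : EuclideanSpace ℝ (Fin n), ‖z - z₀‖ ≤ δ ∧ x = t • z}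
      ⊆ ⋃ k ∈ Finset.range (N + 1), closedBall (((k : ℝ) / N) • z₀) (δ * (1 + R)) := by
    rintro _ ⟨t, ht0, ht1, z, hz, rfl⟩
    have htN : 0 ≤ t * N := by positivity
    have hfl := Nat.floor_le htN
    have hfl2 := Nat.lt_floor_add_one (t * N)
    simp only [mem_iUnion, Finset.mem_range]
    refine ⟨⌊t * N⌋₊, ?_, ?_⟩
    · have : (⌊t * N⌋₊ : ℝ) ≤ N := hfl.trans (by nlinarith)
      exact Nat.lt_succ_of_le (by exact_mod_cast this)
    · rw [mem_closedBall, dist_eq_norm]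
      have hdiff : |t - (⌊t * N⌋₊ : ℝ) / N| ≤ δ := by
        have h1 : 0 ≤ t - (⌊t * N⌋₊ : ℝ) / N := by
          rw [sub_nonneg, div_le_iff₀ hNpos]; exact hfl
        rw [abs_of_nonneg h1]
        have h2 : t - (⌊t * N⌋₊ : ℝ) / N ≤ 1 / N := by
          rw [sub_le_iff_le_add, ← add_div, le_div_iff₀ hNpos]; linarith
        refine h2.trans ?_
        rw [div_le_iff₀ hδ] at hN1
        rw [div_le_iff₀ hNpos]; linarith
      have heq : t • z - ((⌊t * N⌋₊ : ℝ) / N) • z₀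
          = t • (z - z₀) + (t - (⌊t * N⌋₊ : ℝ) / N) • z₀ := by module
      rw [heq]
      refine (norm_add_le _ _).trans ?_
      rw [norm_smul, norm_smul, Real.norm_eq_abs, Real.norm_eq_abs, abs_of_nonneg ht0]
      have h1 : t * ‖z - z₀‖ ≤ 1 * δ := by gcongr
      have h2 : |t - (⌊t * N⌋₊ : ℝ) / N| * ‖z₀‖ ≤ δ * R := by gcongr
      linarith
  refine (measure_mono hsub).trans ((measure_biUnion_finset_le _ _).trans ?_)
  have hball : ∀ k : ℕ, volume (closedBall (((k : ℝ) / N) • z₀) (δ * (1 + R)))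
      = ENNReal.ofReal ((δ * (1 + R)) ^ n) * volume (ball (0 : EuclideanSpace ℝ (Fin n)) 1) := by
    intro k
    rw [Measure.addHaar_closedBall _ _ (by positivity), finrank_euclideanSpace_fin]
  simp only [hball, Finset.sum_const, Finset.card_range, nsmul_eq_mul]
  rw [← mul_assoc, mul_right_comm (ENNReal.ofReal _)]
  refine mul_le_mul_left ?_ _
  rw [ENNReal.ofReal_rpow_of_pos hδ, ← ENNReal.ofReal_natCast,
    ← ENNReal.ofReal_mul (by positivity), ← ENNReal.ofReal_mul (by positivity)]
  refine ENNReal.ofReal_le_ofReal ?_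
  have hpow : δ ^ n = δ * δ ^ ((n : ℝ) - 1) := by
    rw [Real.rpow_sub_one hδ.ne', Real.rpow_natCast]
    field_simp
  rw [mul_pow, hpow]
  have hNδ : ((N + 1 : ℕ) : ℝ) * δ ≤ 3 := by
    have h1 : (N : ℝ) * δ < (1 / δ + 1) * δ := by gcongr
    have h2 : (1 / δ + 1) * δ = 1 + δ := by field_simp
    push_cast
    linarith
  have hr : 0 ≤ δ ^ ((n : ℝ) - 1) := by positivity
  calc ((N + 1 : ℕ) : ℝ) * (δ * δ ^ ((n : ℝ) - 1) * (1 + R) ^ n)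
      = (((N + 1 : ℕ) : ℝ) * δ) * ((1 + R) ^ n * δ ^ ((n : ℝ) - 1)) := by ring
    _ ≤ 3 * ((1 + R) ^ n * δ ^ ((n : ℝ) - 1)) := by gcongr
    _ = _ := by ring

/-- The radial projection of Lebesgue measure is dominated by the boundary measure. -/
lemma exists_map_radProj_le (hn : 1 ≤ n) (hc : Convex ℝ P) (ho : IsOpen P)
    (h0 : (0 : EuclideanSpace ℝ (Fin n)) ∈ P) (hb : Bornology.IsBounded P) :
    ∃ M : ℝ≥0∞, M ≠ 0 ∧ M ≠ ∞ ∧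
      (volume.restrict P).map (radProj P) ≤ M • (sigma0 n) := by
  have : Nonempty (Fin n) := ⟨⟨0, hn⟩⟩
  obtain ⟨R, hR, hPR⟩ := hb.closure.exists_pos_norm_le
  set M : ℝ≥0∞ := ENNReal.ofReal (3 * (1 + R) ^ n)
          * volume (ball (0 : EuclideanSpace ℝ (Fin n)) 1) with hM
  have hM0 : M ≠ 0 := mul_ne_zero (by simp only [ne_eq, ENNReal.ofReal_eq_zero, not_le]; positivity)
    (measure_ball_pos _ _ one_pos).ne'
  have hMt : M ≠ ∞ := ENNReal.mul_ne_top ENNReal.ofReal_ne_top measure_ball_lt_top.ne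
  refine ⟨M, hM0, hMt, ?_⟩
  set μ := (volume.restrict P).map (radProj P) with hμ
  have hmeas := measurable_radProj hc ho h0
  have hne : ∀ᵐ x ∂(volume.restrict P), x ≠ (0 : EuclideanSpace ℝ (Fin n)) :=
    ae_restrict_of_ae (Measure.ae_ne volume 0)
  have hcone : ∀ s : Set (EuclideanSpace ℝ (Fin n)), ediam s ≤ ENNReal.ofReal (1 / 2) →
      μ s ≤ M * ediam s ^ ((n : ℝ) - 1) := by
    intro s hs
    have hfin : ediam s ≠ ∞ := ne_top_of_le_ne_top ENNReal.ofReal_ne_top hs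
    set D := (ediam s).toReal with hD
    have hD2 : D ≤ 1 / 2 := ENNReal.toReal_le_of_le_ofReal (by norm_num) hs
    have hDe : ENNReal.ofReal D = ediam s := ENNReal.ofReal_toReal hfin
    by_cases hemp : ∃ z₀ ∈ s, z₀ ∈ frontier P
    swap
    · have hzero : μ s ≤ μ (frontier P)ᶜ :=
        measure_mono fun z hz hzf => hemp ⟨z, hz, hzf⟩
      have : μ (frontier P)ᶜ = 0 := by
        rw [hμ, Measure.map_apply hmeas isClosed_frontier.measurableSet.compl]
        refine (ae_iff (p := fun x => radProj P x ∈ frontier P)).1 ?_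
        filter_upwards [hne] with x hx using radProj_mem_frontier hc ho h0 hb hx
      rw [this] at hzero
      exact hzero.trans zero_le
    obtain ⟨z₀, hz₀s, hz₀⟩ := hemp
    have hz₀R : ‖z₀‖ ≤ R := hPR _ (frontier_subset_closure hz₀)
    have hbd : ∀ δ ∈ Ioo D 1, μ s ≤ M * ENNReal.ofReal δ ^ ((n : ℝ) - 1) := by
      intro δ hδ
      have hδ0 : 0 < δ := ENNReal.toReal_nonneg.trans_lt hδ.1
      refine le_trans ?_ (volume_cone_le hR.le hδ0 hδ.2.le hz₀R)
      have hss : s ⊆ closedBall z₀ δ := fun z hz => by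
        have h1 : edist z z₀ ≤ ENNReal.ofReal δ := (edist_le_ediam_of_mem hz hz₀s).trans
          (hDe ▸ ENNReal.ofReal_le_ofReal hδ.1.le)
        rw [edist_dist] at h1
        exact (ENNReal.ofReal_le_ofReal_iff hδ0.le).1 h1
      refine (measure_mono hss).trans ?_
      rw [hμ, Measure.map_apply hmeas isClosed_closedBall.measurableSet,
        Measure.restrict_apply (hmeas isClosed_closedBall.measurableSet)]
      refine measure_mono ?_
      rintro x ⟨hx, hxP⟩
      have hx1 := (gauge_lt_one_iff hc ho h0 x).2 hxP
      rcases eq_or_ne x 0 with rfl | hx0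
      · exact ⟨0, le_rfl, zero_le_one, z₀, by simpa using hδ0.le, by simp⟩
      · refine ⟨gauge P x, gauge_nonneg _, hx1.le, radProj P x, ?_, ?_⟩
        · rw [← dist_eq_norm]; exact hx
        · rw [radProj, smul_inv_smul₀ (gauge_pos_of_ne_zero ho h0 hb hx0).ne']
    have hlim : Tendsto (fun δ : ℝ => M * ENNReal.ofReal δ ^ ((n : ℝ) - 1)) (𝓝[>] D)
        (𝓝 (M * ENNReal.ofReal D ^ ((n : ℝ) - 1))) := by
      refine ENNReal.Tendsto.const_mul ?_ (Or.inr hMt)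
      refine Tendsto.mono_left ?_ nhdsWithin_le_nhds
      exact ((ENNReal.continuous_rpow_const.comp ENNReal.continuous_ofReal).tendsto D)
    rw [← hDe]
    refine ge_of_tendsto hlim ?_
    filter_upwards [Ioo_mem_nhdsGT (show D < 1 by linarith)] with δ hδ using hbd δ hδ
  have hle : M⁻¹ • μ ≤ sigma0 n := by
    refine Measure.le_hausdorffMeasure _ _ (ENNReal.ofReal (1 / 2)) (by simp) fun s hs => ?_
    rw [Measure.smul_apply, smul_eq_mul]
    calc M⁻¹ * μ s ≤ M⁻¹ * (M * ediam s ^ ((n : ℝ) - 1)) := by gcongr; exact hcone s hs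
      _ = _ := by rw [← mul_assoc, ENNReal.inv_mul_cancel hM0 hMt, one_mul]
  intro s
  calc μ s = M * (M⁻¹ * μ s) := by rw [← mul_assoc, ENNReal.mul_inv_cancel hM0 hMt, one_mul]
    _ ≤ M * sigma0 n s := by gcongr; exact hle s

lemma smul_mem_of_mem_frontier (hc : Convex ℝ P) (ho : IsOpen P)
    (h0 : (0 : EuclideanSpace ℝ (Fin n)) ∈ P) {z : EuclideanSpace ℝ (Fin n)}
    (hz : z ∈ frontier P) {t : ℝ} (ht0 : 0 ≤ t) (ht1 : t < 1) : t • z ∈ P := by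
  rw [← gauge_eq_one_iff_mem_frontier hc (ho.mem_nhds h0)] at hz
  rw [← gauge_lt_one_iff hc ho h0, gauge_smul_of_nonneg ht0, hz, smul_eq_mul, mul_one]
  exact ht1

/-- Values in the interior are bounded by the radial boundary value on the same ray. -/
lemma ofReal_le_radExt_radProj (hc : Convex ℝ P) (ho : IsOpen P)
    (h0 : (0 : EuclideanSpace ℝ (Fin n)) ∈ P) (hb : Bornology.IsBounded P)
    {u : EuclideanSpace ℝ (Fin n) → ℝ} (hu : ConvexOn ℝ P u) (hu00 : u 0 = 0)
    (hu0 : ∀ x ∈ P, 0 ≤ u x) (hrad : HasRadExt P u) {x : EuclideanSpace ℝ (Fin n)}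
    (hx : x ∈ P) (hx0 : x ≠ 0) : ENNReal.ofReal (u x) ≤ radExt u (radProj P x) := by
  have hz := radProj_mem_frontier hc ho h0 hb hx0
  have hpos := gauge_pos_of_ne_zero ho h0 hb hx0
  refine ge_of_tendsto (hrad _ hz) ?_
  filter_upwards [Ioo_mem_nhdsLT ((gauge_lt_one_iff hc ho h0 x).2 hx)] with t ht
  refine ENNReal.ofReal_le_ofReal ?_
  have ht0 : 0 < t := hpos.trans ht.1
  have hmem := smul_mem_of_mem_frontier hc ho h0 hz ht0.le ht.2
  have hq1 : gauge P x / t ≤ 1 := (div_le_one ht0).2 ht.1.le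
  have hq0 : 0 ≤ gauge P x / t := by positivity
  have hconv := hu.2 hmem h0 hq0 (sub_nonneg.2 hq1) (by ring)
  have hxeq : (gauge P x / t) • t • radProj P x
      + (1 - gauge P x / t) • (0 : EuclideanSpace ℝ (Fin n)) = x := by
    rw [smul_zero, add_zero, smul_smul, div_mul_cancel₀ _ ht0.ne', radProj,
      smul_inv_smul₀ hpos.ne']
  rw [hxeq, hu00, smul_zero, add_zero, smul_eq_mul] at hconv
  have := hu0 _ hmem
  nlinarith

/-- A nonnegative convex function with integrable radial boundary values is integrable. -/
lemma integrableOn_of_lintegral_radExt_lt_top (hn : 1 ≤ n) (hc : Convex ℝ P) (ho : IsOpen P)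
    (h0 : (0 : EuclideanSpace ℝ (Fin n)) ∈ P) (hb : Bornology.IsBounded P)
    {u : EuclideanSpace ℝ (Fin n) → ℝ} (hu : ConvexOn ℝ P u) (hu00 : u 0 = 0)
    (hu0 : ∀ x ∈ P, 0 ≤ u x) (hrad : HasRadExt P u)
    (hfin : ∫⁻ z in frontier P, radExt u z ∂(sigma0 n) < ∞) : IntegrableOn u P := by
  classical
  have : Nonempty (Fin n) := ⟨⟨0, hn⟩⟩
  have hcont : ContinuousOn u P := hu.continuousOn ho
  have hind : Measurable (P.indicator u) := by
    rw [← piecewise_eq_indicator]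
    exact hcont.measurable_piecewise continuousOn_const ho.measurableSet
  set r : ℕ → ℝ := fun k => 1 - 1 / ((k : ℝ) + 1) with hr
  have hr0 : ∀ k, 0 ≤ r k := fun k => by
    have : 1 / ((k : ℝ) + 1) ≤ 1 := by
      rw [div_le_one (by positivity)]; linarith [k.cast_nonneg (α := ℝ)]
    simp only [hr]; linarith
  have hr1 : ∀ k, r k < 1 := fun k => sub_lt_self _ Nat.one_div_pos_of_nat
  have hrlim : Tendsto r atTop (𝓝[<] 1) := by
    refine tendsto_nhdsWithin_iff.2 ⟨?_, Eventually.of_forall hr1⟩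
    simpa [hr] using (tendsto_one_div_add_atTop_nhds_zero_nat (𝕜 := ℝ)).const_sub 1
  set B : EuclideanSpace ℝ (Fin n) → ℝ≥0∞ :=
    fun z => liminf (fun k => ENNReal.ofReal (P.indicator u (r k • z))) atTop with hB
  have hBm : Measurable B := Measurable.liminf fun k =>
    (hind.comp (measurable_const_smul (r k))).ennreal_ofReal
  have hBeq : ∀ z ∈ frontier P, B z = radExt u z := by
    intro z hz
    refine (((hrad z hz).comp hrlim).congr fun k => ?_).liminf_eq
    rw [Function.comp_apply, indicator_of_mem
      (smul_mem_of_mem_frontier hc ho h0 hz (hr0 k) (hr1 k))]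
  obtain ⟨M, -, hMt, hM⟩ := exists_map_radProj_le hn hc ho h0 hb
  have hmeas := measurable_radProj hc ho h0
  have hne : ∀ᵐ x ∂(volume.restrict P), x ≠ (0 : EuclideanSpace ℝ (Fin n)) :=
    ae_restrict_of_ae (Measure.ae_ne volume 0)
  have hfm : MeasurableSet (frontier P) := isClosed_frontier.measurableSet
  have hkey : ∫⁻ x in P, ENNReal.ofReal (u x) < ∞ := by
    calc ∫⁻ x in P, ENNReal.ofReal (u x)
        ≤ ∫⁻ x in P, (frontier P).indicator B (radProj P x) := by
          refine lintegral_mono_ae ?_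
          filter_upwards [hne, ae_restrict_mem ho.measurableSet] with x hx0 hx
          have hz := radProj_mem_frontier hc ho h0 hb hx0
          rw [indicator_of_mem hz, hBeq _ hz]
          exact ofReal_le_radExt_radProj hc ho h0 hb hu hu00 hu0 hrad hx hx0
      _ = ∫⁻ z, (frontier P).indicator B z ∂((volume.restrict P).map (radProj P)) :=
          (lintegral_map (hBm.indicator hfm) hmeas).symm
      _ ≤ ∫⁻ z, (frontier P).indicator B z ∂(M • sigma0 n) := lintegral_mono' hM le_rfl
      _ = M * ∫⁻ z in frontier P, radExt u z ∂(sigma0 n) := by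
          rw [lintegral_smul_measure, lintegral_indicator hfm, smul_eq_mul,
            setLIntegral_congr_fun hfm hBeq]
      _ < ∞ := ENNReal.mul_lt_top hMt.lt_top hfin
  refine ⟨hcont.aestronglyMeasurable ho.measurableSet, ?_⟩
  rw [hasFiniteIntegral_iff_ofReal]
  · exact hkey
  · filter_upwards [ae_restrict_mem ho.measurableSet] with x hx using hu0 x hx

lemma det_le_trace_pow_of_posSemidef {A : Matrix (Fin n) (Fin n) ℝ} (hA : A.PosSemidef) :
    A.det ≤ A.trace ^ n := by
  have hev := hA.eigenvalues_nonneg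
  have hdet := hA.1.det_eq_prod_eigenvalues
  have htr := hA.1.trace_eq_sum_eigenvalues
  simp only [RCLike.ofReal_real_eq_id, id] at hdet htr
  rw [hdet, htr]
  calc ∏ i, hA.1.eigenvalues i ≤ ∏ _i : Fin n, ∑ j, hA.1.eigenvalues j :=
        Finset.prod_le_prod (fun i _ => hev i) fun i _ =>
          Finset.single_le_sum (fun j _ => hev j) (Finset.mem_univ i)
    _ = _ := by simp

lemma log_det_le_of_posSemidef (hn : 1 ≤ n) {A : Matrix (Fin n) (Fin n) ℝ} (hA : A.PosSemidef)
    {b : ℝ} (hb0 : 0 < b) (hb1 : b ≤ 1) :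
    Real.log A.det ≤ n * (b * A.trace + -Real.log b) := by
  have hlogb : 0 ≤ -Real.log b := neg_nonneg.2 (Real.log_nonpos hb0.le hb1)
  have htr : 0 ≤ A.trace := hA.trace_nonneg
  rcases hA.det_nonneg.eq_or_lt with h | h
  · rw [← h, Real.log_zero]
    positivity
  have hpow := det_le_trace_pow_of_posSemidef hA
  have htr' : 0 < A.trace := by
    refine htr.lt_of_ne fun h' => ?_
    rw [← h', zero_pow (by omega)] at hpow
    linarith
  calc Real.log A.det ≤ Real.log (A.trace ^ n) := Real.log_le_log h hpow
    _ = n * Real.log A.trace := Real.log_pow _ _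
    _ ≤ n * (b * A.trace + -Real.log b) := by
        gcongr
        have := Real.log_le_self (mul_pos hb0 htr').le
        rw [Real.log_mul hb0.ne' htr'.ne'] at this
        linarith

/-- On a bounded open convex set, the integral of `log⁺ det H` is controlled by the integral of
the convex function alone. -/
lemma exists_lintegral_log_det_le (hn : 1 ≤ n) (hc : Convex ℝ P) (ho : IsOpen P)
    (h0 : (0 : EuclideanSpace ℝ (Fin n)) ∈ P) (hb : Bornology.IsBounded P) :
    ∃ C C' : ℝ, ∀ (u : EuclideanSpace ℝ (Fin n) → ℝ)
      (H : EuclideanSpace ℝ (Fin n) → Matrix (Fin n) (Fin n) ℝ),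
      ConvexOn ℝ P u → (∀ x ∈ P, 0 ≤ u x) → IntegrableOn u P → IsAlexHessian P u H →
      ∫⁻ x in P, ENNReal.ofReal (Real.log (H x).det)
        ≤ ENNReal.ofReal (C * (∫ x in P, u x) + C') := by
  obtain ⟨M, hM0, hM⟩ := exists_bump_second_difference_le hc ho h0
  set L := ∫⁻ x in P, ENNReal.ofReal (-Real.log (bump P x)) with hL
  have hLt : L ≠ ∞ := (lintegral_neg_log_bump_lt_top hc ho h0 hb).ne
  have hcont := continuous_bump hc ho h0
  refine ⟨n * (n * (3 * M)), n * L.toReal, fun u H hu hu0 hui hH => ?_⟩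
  have hI : 0 ≤ ∫ x in P, u x := setIntegral_nonneg ho.measurableSet hu0
  have hdiag : ∀ i, Measurable fun x => ENNReal.ofReal (bump P x * H x i i) := fun i =>
    (hcont.measurable.mul (hH.1 i i)).ennreal_ofReal
  calc ∫⁻ x in P, ENNReal.ofReal (Real.log (H x).det)
      ≤ ∫⁻ x in P, n * ((∑ i, ENNReal.ofReal (bump P x * H x i i))
          + ENNReal.ofReal (-Real.log (bump P x))) := by
        refine lintegral_mono_ae ?_
        filter_upwards [hH.2, ae_restrict_mem ho.measurableSet] with x hx hxP
        have hpos : 0 < bump P x := by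
          have := (gauge_lt_one_iff hc ho h0 x).2 hxP
          exact pow_pos (lt_max_of_lt_left (by linarith)) 2
        have hd : ∀ i, 0 ≤ bump P x * H x i i := fun i => mul_nonneg hpos.le (hx.1.diag_nonneg)
        have hlog : 0 ≤ -Real.log (bump P x) :=
          neg_nonneg.2 (Real.log_nonpos hpos.le (bump_le_one x))
        rw [← ENNReal.ofReal_sum_of_nonneg fun i _ => hd i,
          ← ENNReal.ofReal_add (Finset.sum_nonneg fun i _ => hd i) hlog,
          ← ENNReal.ofReal_natCast, ← ENNReal.ofReal_mul n.cast_nonneg, ← Finset.mul_sum]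
        exact ENNReal.ofReal_le_ofReal (log_det_le_of_posSemidef hn hx.1 hpos (bump_le_one x))
    _ = n * ((∑ i, ∫⁻ x in P, ENNReal.ofReal (bump P x * H x i i)) + L) := by
        rw [lintegral_const_mul' _ _ (ENNReal.natCast_ne_top n), lintegral_add_left
          (Finset.measurable_fun_sum _ fun i _ => hdiag i),
          lintegral_finsetSum _ fun i _ => hdiag i]
    _ ≤ n * ((∑ _i : Fin n, ENNReal.ofReal (3 * M * ∫ x in P, u x)) + L) := by
        gcongr with i
        exact lintegral_bump_mul_hessian_diag_le hc ho h0 hM0 hM hu hu0 hui hH i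
    _ = ENNReal.ofReal (n * (n * (3 * M)) * (∫ x in P, u x) + n * L.toReal) := by
        rw [Finset.sum_const, Finset.card_univ, Fintype.card_fin, nsmul_eq_mul,
          ← ENNReal.ofReal_toReal hLt, ENNReal.toReal_ofReal ENNReal.toReal_nonneg,
          ← ENNReal.ofReal_natCast, ← ENNReal.ofReal_mul n.cast_nonneg,
          ← ENNReal.ofReal_add (by positivity) ENNReal.toReal_nonneg,
          ← ENNReal.ofReal_mul n.cast_nonneg]
        congr 1
        ring

end ConvexBody

lemma convex_Poly {n : ℕ} {ι : Type*} [Fintype ι] (l : ι → EuclideanSpace ℝ (Fin n))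
    (lam : ι → ℝ) : Convex ℝ (Poly l lam) := by
  simp only [Poly, ofPred_forall]
  exact convex_iInter fun i => convex_halfSpace_lt (innerₗ _ (l i)).isLinear _

lemma isOpen_Poly {n : ℕ} {ι : Type*} [Fintype ι] (l : ι → EuclideanSpace ℝ (Fin n))
    (lam : ι → ℝ) : IsOpen (Poly l lam) := by
  simp only [Poly, ofPred_forall]
  exact isOpen_iInter_of_finite fun i => isOpen_lt (by fun_prop) continuous_const

/-- Remark 2.6: for every `c > 0` there are constants `C, C'` with
`∫_P log det H ≤ c ∫_{∂P} u dσ + C ∫_P u + C'` for all `u ∈ 𝒞⋆^K(P)`. -/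
theorem logdet_bound_small_boundary_coefficient
    (n d : ℕ) (hn : 1 ≤ n) (l : Fin d → EuclideanSpace ℝ (Fin n)) (lam : Fin d → ℝ)
    (hl : ∀ i, l i ≠ 0) (hlam : ∀ i, 0 < lam i)
    (hbd : Bornology.IsBounded (Poly l lam)) (hDel : IsDelzant l lam) :
    ∀ c : ℝ, 0 < c → ∃ C C' : ℝ, ∀ (K : ℝ), 0 < K →
      ∀ (u : EuclideanSpace ℝ (Fin n) → ℝ)
        (H : EuclideanSpace ℝ (Fin n) → Matrix (Fin n) (Fin n) ℝ),
      MemCstar l lam K u → IsAlexHessian (Poly l lam) u H →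
      logDetE (Poly l lam) H ≤
        ((ENNReal.ofReal c * ∫⁻ z, radExt u z ∂(sigmaW l lam) : ℝ≥0∞) : EReal)
          + ((C * ∫ x in Poly l lam, u x + C' : ℝ) : EReal) := by
  have hc := convex_Poly l lam
  have ho := isOpen_Poly l lam
  have h0 : (0 : EuclideanSpace ℝ (Fin n)) ∈ Poly l lam := fun i => by simpa using hlam i
  obtain ⟨C, C', hCC'⟩ := exists_lintegral_log_det_le hn hc ho h0 hbd
  set V := volume.real (Poly l lam) with hV
  have hVpos : 0 < V :=
    ENNReal.toReal_pos (ho.measure_pos volume ⟨0, h0⟩).ne' hbd.measure_lt_top.ne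
  have hCpos : 0 < |C| + 1 := by positivity
  intro c _
  refine ⟨|C| + 1, |C'| / ((|C| + 1) * V), fun K _ u H hu hH => ?_⟩
  obtain ⟨hconv, hu00, hu0, hrad, hK⟩ := hu
  have hui : IntegrableOn u (Poly l lam) := integrableOn_of_lintegral_radExt_lt_top hn hc ho h0 hbd
    hconv hu00 hu0 hrad (hK.trans_lt ENNReal.ofReal_lt_top)
  have hI : 0 ≤ ∫ x in Poly l lam, u x := setIntegral_nonneg ho.measurableSet hu0
  have hA := hCC' u H hconv hu0 hui hH
  have hint : (|C| + 1) * ∫ x in Poly l lam, (u x + |C'| / ((|C| + 1) * V))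
      = (|C| + 1) * (∫ x in Poly l lam, u x) + |C'| := by
    rw [integral_add hui (integrableOn_const hbd.measure_lt_top.ne), setIntegral_const, smul_eq_mul,
      ← hV]
    field_simp
  have hle : C * (∫ x in Poly l lam, u x) + C' ≤ (|C| + 1) * (∫ x in Poly l lam, u x) + |C'| := by
    gcongr
    · linarith [le_abs_self C]
    · exact le_abs_self C'
  have hnonneg : 0 ≤ (|C| + 1) * (∫ x in Poly l lam, u x) + |C'| := by positivity
  rw [hint]
  calc logDetE (Poly l lam) H
      ≤ ((∫⁻ x in Poly l lam, ENNReal.ofReal (Real.log (H x).det) : ℝ≥0∞) : EReal) :=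
        EReal.sub_le_of_le_add (le_add_of_nonneg_right (EReal.coe_ennreal_nonneg _))
    _ ≤ ((ENNReal.ofReal ((|C| + 1) * (∫ x in Poly l lam, u x) + |C'|) : ℝ≥0∞) : EReal) :=
        EReal.coe_ennreal_le_coe_ennreal_iff.2 (hA.trans (ENNReal.ofReal_le_ofReal hle))
    _ = (((|C| + 1) * (∫ x in Poly l lam, u x) + |C'| : ℝ) : EReal) := by
        rw [EReal.coe_ennreal_ofReal, max_eq_left hnonneg]
    _ ≤ _ := le_add_of_nonneg_left (EReal.coe_ennreal_nonneg _)

end ToricExtremal
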